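/- arXiv:1205.5878 — 2 statements merged into one kernel-verified Lean document; each statement's English description precedes it below -/
import Mathlib

section
/- (Berger's inequality) Let M be a Riemannian manifold whose sectional curvatures at a point p all lie in the interval [k̲, k̄]. Then for any orthonormal 4-frame {e₁, e₂, e₃, e₄} in T_pM, the curvature tensor satisfies |R(e₁,e₂,e₃,e₄)| ≤ (2/3)(k̄ − k̲). -/
open scoped InnerProductSpace

noncomputable section

/-- The data of a Riemannian manifold of dimension `n`, presented through a fixed
orthonormal trivialization of its tangent bundle by `EuclideanSpace ℝ (Fin n)`:
the underlying topological space together with its Riemann curvature tensor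
`R p x y z w = ⟪R(x,y)z, w⟫` at each point `p`, a quadrilinear form satisfying the usual
curvature symmetries and the first Bianchi identity.  The sectional curvature of the
2-plane spanned by orthonormal vectors `x, y` at `p` is `R p x y x y`. -/
structure RiemannianManifold (n : ℕ) : Type 1 where
  /-- The underlying set of points of the manifold. -/
  Carrier : Type
  [topCarrier : TopologicalSpace Carrier]
  [nonemptyCarrier : Nonempty Carrier]
  /-- The Riemann curvature tensor `R p x y z w = ⟪R(x,y)z, w⟫` at the point `p`, expressed
  in the orthonormal trivialization of the tangent bundle. -/
  R : Carrier → EuclideanSpace ℝ (Fin n) → EuclideanSpace ℝ (Fin n) →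
      EuclideanSpace ℝ (Fin n) → EuclideanSpace ℝ (Fin n) → ℝ
  R_add_left : ∀ p x x' y z w, R p (x + x') y z w = R p x y z w + R p x' y z w
  R_smul_left : ∀ p (a : ℝ) x y z w, R p (a • x) y z w = a * R p x y z w
  R_antisymm_left : ∀ p x y z w, R p x y z w = - R p y x z w
  R_antisymm_right : ∀ p x y z w, R p x y z w = - R p x y w z
  R_pair_symm : ∀ p x y z w, R p x y z w = R p z w x y
  R_bianchi : ∀ p x y z w, R p x y z w + R p y z x w + R p z x y w = 0

namespace RiemannianManifold

variable {n : ℕ} (X : RiemannianManifold n) (p : X.Carrier)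

theorem R_add_two (x y y' z w : EuclideanSpace ℝ (Fin n)) :
    X.R p x (y + y') z w = X.R p x y z w + X.R p x y' z w := by
  rw [X.R_antisymm_left p x (y + y'), X.R_add_left, X.R_antisymm_left p x y,
    X.R_antisymm_left p x y']
  ring

theorem R_add_three (x y z z' w : EuclideanSpace ℝ (Fin n)) :
    X.R p x y (z + z') w = X.R p x y z w + X.R p x y z' w := by
  rw [X.R_pair_symm p x y (z + z'), X.R_add_left, X.R_pair_symm p x y z,
    X.R_pair_symm p x y z']

theorem R_add_four (x y z w w' : EuclideanSpace ℝ (Fin n)) :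
    X.R p x y z (w + w') = X.R p x y z w + X.R p x y z w' := by
  rw [X.R_pair_symm p x y z (w + w'), R_add_two, X.R_pair_symm p x y z w,
    X.R_pair_symm p x y z w']

theorem R_smul_two (a : ℝ) (x y z w : EuclideanSpace ℝ (Fin n)) :
    X.R p x (a • y) z w = a * X.R p x y z w := by
  rw [X.R_antisymm_left p x (a • y), X.R_smul_left, X.R_antisymm_left p x y]
  ring

theorem R_smul_three (a : ℝ) (x y z w : EuclideanSpace ℝ (Fin n)) :
    X.R p x y (a • z) w = a * X.R p x y z w := by
  rw [X.R_pair_symm p x y (a • z), X.R_smul_left, X.R_pair_symm p x y z]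

theorem R_smul_four (a : ℝ) (x y z w : EuclideanSpace ℝ (Fin n)) :
    X.R p x y z (a • w) = a * X.R p x y z w := by
  rw [X.R_pair_symm p x y z (a • w), R_smul_two, X.R_pair_symm p x y z w]

/-- Curvature bounds for orthogonal vectors of squared length two. -/
theorem sec_two {kmin kmax : ℝ}
    (hsec : ∀ x y : EuclideanSpace ℝ (Fin n), ‖x‖ = 1 → ‖y‖ = 1 → ⟪x, y⟫_ℝ = 0 →
      X.R p x y x y ∈ Set.Icc kmin kmax)
    (x y : EuclideanSpace ℝ (Fin n)) (hx : ⟪x, x⟫_ℝ = 2) (hy : ⟪y, y⟫_ℝ = 2)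
    (hxy : ⟪x, y⟫_ℝ = 0) :
    4 * kmin ≤ X.R p x y x y ∧ X.R p x y x y ≤ 4 * kmax := by
  have hs : (√2 : ℝ)⁻¹ * (√2)⁻¹ = 1 / 2 := by
    rw [← mul_inv, Real.mul_self_sqrt (by norm_num)]; norm_num
  have hn : ∀ v : EuclideanSpace ℝ (Fin n), ⟪v, v⟫_ℝ = 2 → ‖(√2 : ℝ)⁻¹ • v‖ = 1 := by
    intro v hv
    rw [real_inner_self_eq_norm_sq] at hv
    have h : ‖v‖ = √2 := by rw [← hv, Real.sqrt_sq (norm_nonneg v)]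
    rw [norm_smul, h, Real.norm_of_nonneg (by positivity)]
    exact inv_mul_cancel₀ (by positivity)
  have h := hsec ((√2 : ℝ)⁻¹ • x) ((√2 : ℝ)⁻¹ • y) (hn x hx) (hn y hy)
    (by rw [real_inner_smul_left, real_inner_smul_right, hxy]; simp)
  rw [X.R_smul_left, R_smul_two, R_smul_three, R_smul_four] at h
  have e : (√2 : ℝ)⁻¹ * ((√2)⁻¹ * ((√2)⁻¹ * ((√2)⁻¹ * X.R p x y x y)))
      = X.R p x y x y / 4 := by
    linear_combination ((√2 : ℝ)⁻¹ * (√2)⁻¹ + 1 / 2) * X.R p x y x y * hs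
  rw [e] at h
  obtain ⟨h1, h2⟩ := h
  constructor <;> linarith

/-- Polarization in the first/third and second/fourth arguments. -/
theorem polar (x y z w : EuclideanSpace ℝ (Fin n)) :
    X.R p (x + z) (y + w) (x + z) (y + w)
      - X.R p (x + z) (y + (-1 : ℝ) • w) (x + z) (y + (-1 : ℝ) • w)
      - X.R p (x + (-1 : ℝ) • z) (y + w) (x + (-1 : ℝ) • z) (y + w)
      + X.R p (x + (-1 : ℝ) • z) (y + (-1 : ℝ) • w) (x + (-1 : ℝ) • z) (y + (-1 : ℝ) • w)
    = 8 * (X.R p x y z w + X.R p x w z y) := by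
  simp only [X.R_add_left, R_add_two, R_add_three, R_add_four, X.R_smul_left, R_smul_two,
    R_smul_three, R_smul_four]
  linear_combination (-4) * X.R_pair_symm p x y z w - 4 * X.R_pair_symm p x w z y

theorem polar_bound {kmin kmax : ℝ}
    (hsec : ∀ x y : EuclideanSpace ℝ (Fin n), ‖x‖ = 1 → ‖y‖ = 1 → ⟪x, y⟫_ℝ = 0 →
      X.R p x y x y ∈ Set.Icc kmin kmax)
    (x y z w : EuclideanSpace ℝ (Fin n))
    (hxx : ⟪x, x⟫_ℝ = 1) (hyy : ⟪y, y⟫_ℝ = 1) (hzz : ⟪z, z⟫_ℝ = 1) (hww : ⟪w, w⟫_ℝ = 1)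
    (hxy : ⟪x, y⟫_ℝ = 0) (hxz : ⟪x, z⟫_ℝ = 0) (hxw : ⟪x, w⟫_ℝ = 0)
    (hyz : ⟪y, z⟫_ℝ = 0) (hyw : ⟪y, w⟫_ℝ = 0) (hzw : ⟪z, w⟫_ℝ = 0) :
    |X.R p x y z w + X.R p x w z y| ≤ kmax - kmin := by
  have hzx : ⟪z, x⟫_ℝ = 0 := by rw [real_inner_comm, hxz]
  have hzy : ⟪z, y⟫_ℝ = 0 := by rw [real_inner_comm, hyz]
  have hwy : ⟪w, y⟫_ℝ = 0 := by rw [real_inner_comm, hyw]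
  have key : ∀ a b : ℝ, a * a = 1 → b * b = 1 →
      4 * kmin ≤ X.R p (x + a • z) (y + b • w) (x + a • z) (y + b • w) ∧
      X.R p (x + a • z) (y + b • w) (x + a • z) (y + b • w) ≤ 4 * kmax := by
    intro a b ha hb
    apply X.sec_two p hsec
    · simp only [inner_add_left, inner_add_right, real_inner_smul_left, real_inner_smul_right,
        hxx, hxz, hzx, hzz]
      linarith
    · simp only [inner_add_left, inner_add_right, real_inner_smul_left, real_inner_smul_right,
        hyy, hyw, hwy, hww]
      linarith
    · simp only [inner_add_left, inner_add_right, real_inner_smul_left, real_inner_smul_right,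
        hxy, hxw, hzy, hzw]
      ring
  have h1 := key 1 1 (by norm_num) (by norm_num)
  have h2 := key 1 (-1) (by norm_num) (by norm_num)
  have h3 := key (-1) 1 (by norm_num) (by norm_num)
  have h4 := key (-1) (-1) (by norm_num) (by norm_num)
  have hp := X.polar p x y z w
  simp only [one_smul] at h1 h2 h3
  rw [abs_le]
  constructor <;> linarith [h1.1, h1.2, h2.1, h2.2, h3.1, h3.2, h4.1, h4.2]

end RiemannianManifold

/-- **Berger's inequality.** Let `M` be a Riemannian manifold whose sectional curvatures at
a point `p` all lie in the interval `[k̲, k̄]`.  Then for any orthonormal 4-frame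
`{e₁, e₂, e₃, e₄}` in `T_pM` the curvature tensor satisfies
`|R(e₁, e₂, e₃, e₄)| ≤ (2/3)(k̄ - k̲)`. -/
theorem berger_inequality
    (n : ℕ) (X : RiemannianManifold n) (p : X.Carrier) (kmin kmax : ℝ)
    (hsec : ∀ x y : EuclideanSpace ℝ (Fin n), ‖x‖ = 1 → ‖y‖ = 1 → ⟪x, y⟫_ℝ = 0 →
      X.R p x y x y ∈ Set.Icc kmin kmax)
    (e : Fin 4 → EuclideanSpace ℝ (Fin n)) (he : Orthonormal ℝ e) :
    |X.R p (e 0) (e 1) (e 2) (e 3)| ≤ 2 / 3 * (kmax - kmin) := by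
  have h1 : ∀ i, ⟪e i, e i⟫_ℝ = 1 := fun i => by
    rw [real_inner_self_eq_norm_sq, he.1 i]; norm_num
  have h0 : ∀ i j, i ≠ j → ⟪e i, e j⟫_ℝ = 0 := fun i j hij => he.2 hij
  have a := X.polar_bound p hsec (e 0) (e 1) (e 2) (e 3) (h1 _) (h1 _) (h1 _) (h1 _)
    (h0 _ _ (by decide)) (h0 _ _ (by decide)) (h0 _ _ (by decide)) (h0 _ _ (by decide))
    (h0 _ _ (by decide)) (h0 _ _ (by decide))
  have b := X.polar_bound p hsec (e 1) (e 0) (e 2) (e 3) (h1 _) (h1 _) (h1 _) (h1 _)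
    (h0 _ _ (by decide)) (h0 _ _ (by decide)) (h0 _ _ (by decide)) (h0 _ _ (by decide))
    (h0 _ _ (by decide)) (h0 _ _ (by decide))
  have c1 := X.R_bianchi p (e 0) (e 1) (e 2) (e 3)
  have c2 := X.R_antisymm_left p (e 1) (e 2) (e 0) (e 3)
  have c3 := X.R_pair_symm p (e 0) (e 3) (e 2) (e 1)
  have c4 := X.R_pair_symm p (e 1) (e 3) (e 2) (e 0)
  have c5 := X.R_antisymm_left p (e 0) (e 1) (e 2) (e 3)
  rw [abs_le] at a b ⊢
  constructor <;> linarith [a.1, a.2, b.1, b.2]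
end
end

section
/- Let M be a compact Riemannian manifold of dimension 2m or 2m+1 with all sectional curvatures in [k̲, k̄], and suppose Ric(v,v) > k̄ + ((2m−2)/3)(k̄ − k̲) for every unit tangent vector v. Let φ be a 2-form on M and p ∈ M, and write φ(p) = Σ_{α=1}^m λ_α v_α* ∧ w_α* in a diagonalizing orthonormal basis at p. Then the quantity F(φ)(p) = Σ_{α=1}^{m} λ_α²[Ric(v_α,v_α) + Ric(w_α,w_α)] − 2 Σ_{α,β=1}^{m} λ_α λ_β R(v_α,w_α,v_β,w_β) satisfies F(φ)(p) ≥ 0, with equality if and only if φ(p) = 0. -/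
open scoped InnerProductSpace

noncomputable section

/-- The data of a compact (connected, without boundary) Riemannian manifold of dimension `n`,
presented through a fixed orthonormal trivialization of its tangent bundle by
`EuclideanSpace ℝ (Fin n)`: the underlying compact connected topological space together with
its Riemann curvature tensor `R p x y z w = ⟪R(x,y)z, w⟫` at each point `p` (a quadrilinear
form satisfying the usual curvature symmetries and the first Bianchi identity), and its Betti
numbers `betti k`, the ranks of the de Rham cohomology groups `H^k_dR(M)`. -/
structure CompactRiemannianManifold (n : ℕ) : Type 1 where
  /-- The underlying set of points of the manifold. -/
  Carrier : Type
  [topCarrier : TopologicalSpace Carrier]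
  [compactCarrier : CompactSpace Carrier]
  [connectedCarrier : ConnectedSpace Carrier]
  [nonemptyCarrier : Nonempty Carrier]
  /-- The Riemann curvature tensor `R p x y z w = ⟪R(x,y)z, w⟫` at the point `p`, expressed
  in the orthonormal trivialization of the tangent bundle. -/
  R : Carrier → EuclideanSpace ℝ (Fin n) → EuclideanSpace ℝ (Fin n) →
      EuclideanSpace ℝ (Fin n) → EuclideanSpace ℝ (Fin n) → ℝ
  R_add_left : ∀ p x x' y z w, R p (x + x') y z w = R p x y z w + R p x' y z w
  R_smul_left : ∀ p (a : ℝ) x y z w, R p (a • x) y z w = a * R p x y z w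
  R_antisymm_left : ∀ p x y z w, R p x y z w = - R p y x z w
  R_antisymm_right : ∀ p x y z w, R p x y z w = - R p x y w z
  R_pair_symm : ∀ p x y z w, R p x y z w = R p z w x y
  R_bianchi : ∀ p x y z w, R p x y z w + R p y z x w + R p z x y w = 0
  /-- `betti k` is the `k`-th Betti number of the manifold, i.e. the rank of the `k`-th
  de Rham cohomology group `H^k_dR(M)`. -/
  betti : ℕ → ℕ

namespace CompactRiemannianManifold

variable {n : ℕ}

/-- The Ricci curvature `Ric(x, y) = Σ_k ⟪R(v_k, x) v_k, y⟫` at the point `p`, the trace of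
the curvature tensor over the orthonormal frame `v_k`. -/
def ricci (X : CompactRiemannianManifold n) (p : X.Carrier)
    (x y : EuclideanSpace ℝ (Fin n)) : ℝ :=
  ∑ k : Fin n, X.R p (EuclideanSpace.single k 1) x (EuclideanSpace.single k 1) y

/-- The set of all sectional curvatures of `X`: the values `K(σ) = R(x, y, x, y)` over all
tangent 2-planes `σ`, described by orthonormal pairs `x, y` spanning them. -/
def sectionalCurvatures (X : CompactRiemannianManifold n) : Set ℝ :=
  {k | ∃ (p : X.Carrier) (x y : EuclideanSpace ℝ (Fin n)),
    ‖x‖ = 1 ∧ ‖y‖ = 1 ∧ ⟪x, y⟫_ℝ = 0 ∧ k = X.R p x y x y}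

end CompactRiemannianManifold

namespace CompactRiemannianManifold

theorem R_add2 {n : ℕ} (X : CompactRiemannianManifold n) (p : X.Carrier)
    (x y y' z w : EuclideanSpace ℝ (Fin n)) :
    X.R p x (y + y') z w = X.R p x y z w + X.R p x y' z w := by
  rw [X.R_antisymm_left, X.R_add_left, X.R_antisymm_left p y, X.R_antisymm_left p y']; ring

theorem R_add3 {n : ℕ} (X : CompactRiemannianManifold n) (p : X.Carrier)
    (x y z z' w : EuclideanSpace ℝ (Fin n)) :
    X.R p x y (z + z') w = X.R p x y z w + X.R p x y z' w := by
  rw [X.R_pair_symm, X.R_add_left, X.R_pair_symm p z, X.R_pair_symm p z']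

theorem R_add4 {n : ℕ} (X : CompactRiemannianManifold n) (p : X.Carrier)
    (x y z w w' : EuclideanSpace ℝ (Fin n)) :
    X.R p x y z (w + w') = X.R p x y z w + X.R p x y z w' := by
  rw [X.R_pair_symm, X.R_add2, X.R_pair_symm p z, X.R_pair_symm p z w']

theorem R_smul2 {n : ℕ} (X : CompactRiemannianManifold n) (p : X.Carrier) (a : ℝ)
    (x y z w : EuclideanSpace ℝ (Fin n)) :
    X.R p x (a • y) z w = a * X.R p x y z w := by
  rw [X.R_antisymm_left, X.R_smul_left, X.R_antisymm_left p y]; ring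

theorem R_smul3 {n : ℕ} (X : CompactRiemannianManifold n) (p : X.Carrier) (a : ℝ)
    (x y z w : EuclideanSpace ℝ (Fin n)) :
    X.R p x y (a • z) w = a * X.R p x y z w := by
  rw [X.R_pair_symm, X.R_smul_left, X.R_pair_symm p z]

theorem R_smul4 {n : ℕ} (X : CompactRiemannianManifold n) (p : X.Carrier) (a : ℝ)
    (x y z w : EuclideanSpace ℝ (Fin n)) :
    X.R p x y z (a • w) = a * X.R p x y z w := by
  rw [X.R_pair_symm, X.R_smul2, X.R_pair_symm p z]

theorem sec_bound {n : ℕ} (X : CompactRiemannianManifold n) (kmin kmax : ℝ)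
    (hsec : ∀ k ∈ X.sectionalCurvatures, k ∈ Set.Icc kmin kmax) (p : X.Carrier)
    (x y : EuclideanSpace ℝ (Fin n)) (hx : ⟪x, x⟫_ℝ = 2) (hy : ⟪y, y⟫_ℝ = 2)
    (hxy : ⟪x, y⟫_ℝ = 0) :
    4 * kmin ≤ X.R p x y x y ∧ X.R p x y x y ≤ 4 * kmax := by
  have hs : (√2 : ℝ) * √2 = 2 := Real.mul_self_sqrt (by norm_num)
  have hpos : (0 : ℝ) < √2 := by positivity
  have key : ∀ u : EuclideanSpace ℝ (Fin n), ⟪u, u⟫_ℝ = 2 → ‖(√2)⁻¹ • u‖ = 1 := by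
    intro u hu
    have h1 : ‖u‖ = √2 := by
      rw [norm_eq_sqrt_real_inner, hu]
    rw [norm_smul, h1, norm_inv, Real.norm_of_nonneg hpos.le]
    field_simp
  have h := hsec _ ⟨p, (√2)⁻¹ • x, (√2)⁻¹ • y, key x hx, key y hy, by
    rw [inner_smul_left, inner_smul_right, hxy]; simp, rfl⟩
  rw [X.R_smul_left, X.R_smul2, X.R_smul3, X.R_smul4] at h
  have h2 : (√2)⁻¹ * (√2)⁻¹ = (1 / 2 : ℝ) := by
    rw [← mul_inv, hs]; norm_num
  have h4 : (√2)⁻¹ * ((√2)⁻¹ * ((√2)⁻¹ * ((√2)⁻¹ * X.R p x y x y))) = X.R p x y x y / 4 := by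
    calc _ = ((√2)⁻¹ * (√2)⁻¹) * ((√2)⁻¹ * (√2)⁻¹) * X.R p x y x y := by ring
      _ = _ := by rw [h2]; ring
  rw [h4] at h
  constructor <;> linarith [h.1, h.2]

theorem half_bound {n : ℕ} (X : CompactRiemannianManifold n) (kmin kmax : ℝ)
    (hsec : ∀ k ∈ X.sectionalCurvatures, k ∈ Set.Icc kmin kmax) (p : X.Carrier)
    (x y z w : EuclideanSpace ℝ (Fin n)) (hx : ⟪x, x⟫_ℝ = 1) (hy : ⟪y, y⟫_ℝ = 1)
    (hz : ⟪z, z⟫_ℝ = 1) (hw : ⟪w, w⟫_ℝ = 1) (hxy : ⟪x, y⟫_ℝ = 0) (hxz : ⟪x, z⟫_ℝ = 0)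
    (hxw : ⟪x, w⟫_ℝ = 0) (hyz : ⟪y, z⟫_ℝ = 0) (hyw : ⟪y, w⟫_ℝ = 0) (hzw : ⟪z, w⟫_ℝ = 0) :
    |X.R p x y z w + X.R p x w z y| ≤ kmax - kmin := by
  have hzx : ⟪z, x⟫_ℝ = 0 := by rw [real_inner_comm]; exact hxz
  have hzy : ⟪z, y⟫_ℝ = 0 := by rw [real_inner_comm]; exact hyz
  have hwy : ⟪w, y⟫_ℝ = 0 := by rw [real_inner_comm]; exact hyw
  have key : ∀ s t : ℝ, s * s = 1 → t * t = 1 →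
      4 * kmin ≤ X.R p (x + s • z) (y + t • w) (x + s • z) (y + t • w) ∧
      X.R p (x + s • z) (y + t • w) (x + s • z) (y + t • w) ≤ 4 * kmax := by
    intro s t hs ht
    apply X.sec_bound kmin kmax hsec p
    · simp only [inner_add_left, inner_add_right, real_inner_smul_left, real_inner_smul_right,
        hx, hz, hxz, hzx]
      linarith
    · simp only [inner_add_left, inner_add_right, real_inner_smul_left, real_inner_smul_right,
        hy, hw, hyw, hwy]
      linarith
    · simp only [inner_add_left, inner_add_right, real_inner_smul_left, real_inner_smul_right,
        hxy, hxw, hzy, hzw]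
      ring
  have a := key 1 1 (by norm_num) (by norm_num)
  have b := key 1 (-1) (by norm_num) (by norm_num)
  have c := key (-1) 1 (by norm_num) (by norm_num)
  have d := key (-1) (-1) (by norm_num) (by norm_num)
  simp only [X.R_add_left, X.R_add2, X.R_add3, X.R_add4, X.R_smul_left, X.R_smul2, X.R_smul3,
    X.R_smul4] at a b c d
  have e1 := X.R_pair_symm p z w x y
  have e2 := X.R_pair_symm p z y x w
  rw [abs_le]
  constructor <;> linarith [a.1, a.2, b.1, b.2, c.1, c.2, d.1, d.2]

/-- Berger's inequality. -/
theorem berger {n : ℕ} (X : CompactRiemannianManifold n) (kmin kmax : ℝ)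
    (hsec : ∀ k ∈ X.sectionalCurvatures, k ∈ Set.Icc kmin kmax) (p : X.Carrier)
    (x y z w : EuclideanSpace ℝ (Fin n)) (hx : ⟪x, x⟫_ℝ = 1) (hy : ⟪y, y⟫_ℝ = 1)
    (hz : ⟪z, z⟫_ℝ = 1) (hw : ⟪w, w⟫_ℝ = 1) (hxy : ⟪x, y⟫_ℝ = 0) (hxz : ⟪x, z⟫_ℝ = 0)
    (hxw : ⟪x, w⟫_ℝ = 0) (hyz : ⟪y, z⟫_ℝ = 0) (hyw : ⟪y, w⟫_ℝ = 0) (hzw : ⟪z, w⟫_ℝ = 0) :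
    |X.R p x y z w| ≤ 2 / 3 * (kmax - kmin) := by
  have hyx : ⟪y, x⟫_ℝ = 0 := by rw [real_inner_comm]; exact hxy
  have h1 := X.half_bound kmin kmax hsec p x y z w hx hy hz hw hxy hxz hxw hyz hyw hzw
  have h2 := X.half_bound kmin kmax hsec p y x z w hy hx hz hw hyx hyz hyw hxz hxw hzw
  have b := X.R_bianchi p x y z w
  have e1 : X.R p x w z y = - X.R p y z x w := by
    rw [X.R_pair_symm p x w z y, X.R_antisymm_left]
  have e2 : X.R p y w z x = X.R p z x y w := X.R_pair_symm p y w z x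
  have e3 := X.R_antisymm_left p y x z w
  rw [e1] at h1
  rw [e2, e3] at h2
  rw [abs_le] at *
  constructor <;> linarith [h1.1, h1.2, h2.1, h2.2]

end CompactRiemannianManifold

/-- Let `M` be a compact Riemannian manifold of dimension `2m` or `2m + 1` with all
sectional curvatures in `[k̲, k̄]`, and suppose `Ric(v, v) > k̄ + ((2m - 2)/3)(k̄ - k̲)`
for every unit tangent vector `v`.  Let `φ` be a 2-form and `p ∈ M`, and write
`φ(p) = Σ_α λ_α v_α* ∧ w_α*` in a diagonalizing orthonormal basis `{v_α, w_α}` at `p`.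
Then the quantity
`F(φ)(p) = Σ_α λ_α² [Ric(v_α, v_α) + Ric(w_α, w_α)] − 2 Σ_{α,β} λ_α λ_β R(v_α, w_α, v_β, w_β)`
satisfies `F(φ)(p) ≥ 0`, with equality if and only if `φ(p) = 0` (i.e. all `λ_α` vanish). -/
theorem F_nonneg_of_ricci_large
    (m n : ℕ) (hn : n = 2 * m ∨ n = 2 * m + 1)
    (X : CompactRiemannianManifold n) (kmin kmax : ℝ)
    (hsec : ∀ k ∈ X.sectionalCurvatures, k ∈ Set.Icc kmin kmax)
    (hRic : ∀ (q : X.Carrier) (u : EuclideanSpace ℝ (Fin n)), ‖u‖ = 1 →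
      X.ricci q u u > kmax + (2 * (m : ℝ) - 2) / 3 * (kmax - kmin))
    (p : X.Carrier) (v w : Fin m → EuclideanSpace ℝ (Fin n))
    (hvw : Orthonormal ℝ (Sum.elim v w)) (lam : Fin m → ℝ) :
    0 ≤ (∑ α : Fin m, (lam α) ^ 2 * (X.ricci p (v α) (v α) + X.ricci p (w α) (w α))) -
        2 * ∑ α : Fin m, ∑ β : Fin m, lam α * lam β * X.R p (v α) (w α) (v β) (w β) ∧
    ((∑ α : Fin m, (lam α) ^ 2 * (X.ricci p (v α) (v α) + X.ricci p (w α) (w α))) -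
        2 * ∑ α : Fin m, ∑ β : Fin m, lam α * lam β * X.R p (v α) (w α) (v β) (w β) = 0 ↔
      ∀ α : Fin m, lam α = 0) := by
  classical
  have hinner := orthonormal_iff_ite.mp hvw
  have hvv : ∀ a b, ⟪v a, v b⟫_ℝ = if a = b then 1 else 0 := fun a b => by
    simpa using hinner (Sum.inl a) (Sum.inl b)
  have hww : ∀ a b, ⟪w a, w b⟫_ℝ = if a = b then 1 else 0 := fun a b => by
    simpa using hinner (Sum.inr a) (Sum.inr b)
  have hvw' : ∀ a b, ⟪v a, w b⟫_ℝ = 0 := fun a b => by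
    simpa using hinner (Sum.inl a) (Sum.inr b)
  have hwv : ∀ a b, ⟪w a, v b⟫_ℝ = 0 := fun a b => by
    simpa using hinner (Sum.inr a) (Sum.inl b)
  have hnv : ∀ a, ‖v a‖ = 1 := fun a => hvw.1 (Sum.inl a)
  have hnw : ∀ a, ‖w a‖ = 1 := fun a => hvw.1 (Sum.inr a)
  set D : ℝ := kmax - kmin with hD
  set F : ℝ := (∑ α : Fin m, (lam α) ^ 2 * (X.ricci p (v α) (v α) + X.ricci p (w α) (w α))) -
        2 * ∑ α : Fin m, ∑ β : Fin m, lam α * lam β * X.R p (v α) (w α) (v β) (w β) with hF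
  -- termwise bound of the double sum
  have hterm : ∀ α β : Fin m, lam α * lam β * X.R p (v α) (w α) (v β) (w β) ≤
      (lam α ^ 2 + lam β ^ 2) * (D / 3) +
        (if α = β then lam α ^ 2 * (kmax - 2 / 3 * D) else 0) := by
    intro α β
    by_cases h : α = β
    · subst h
      have hs := (hsec _ ⟨p, v α, w α, hnv α, hnw α, hvw' α α, rfl⟩).2
      rw [if_pos rfl]
      nlinarith [mul_le_mul_of_nonneg_left hs (sq_nonneg (lam α))]
    · rw [if_neg h]
      have hb := X.berger kmin kmax hsec p (v α) (w α) (v β) (w β) (by simp [hnv])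
        (by simp [hnw]) (by simp [hnv]) (by simp [hnw]) (hvw' _ _) (by simp [hvv, h])
        (hvw' _ _) (hwv _ _) (by simp [hww, h]) (hvw' _ _)
      have hl : |lam α * lam β| ≤ (lam α ^ 2 + lam β ^ 2) / 2 := by
        rw [abs_le]
        constructor <;> nlinarith [sq_nonneg (lam α + lam β), sq_nonneg (lam α - lam β)]
      calc _ ≤ |lam α * lam β * X.R p (v α) (w α) (v β) (w β)| := le_abs_self _
        _ = |lam α * lam β| * |X.R p (v α) (w α) (v β) (w β)| := abs_mul _ _
        _ ≤ (lam α ^ 2 + lam β ^ 2) / 2 * (2 / 3 * D) :=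
          mul_le_mul hl hb (abs_nonneg _) (by positivity)
        _ = _ := by ring
  have hsum : ∑ α : Fin m, ∑ β : Fin m, lam α * lam β * X.R p (v α) (w α) (v β) (w β) ≤
      ∑ α : Fin m, lam α ^ 2 * (kmax + (2 * (m : ℝ) - 2) / 3 * D) := by
    calc _ ≤ ∑ α : Fin m, ∑ β : Fin m, ((lam α ^ 2 + lam β ^ 2) * (D / 3) +
        (if α = β then lam α ^ 2 * (kmax - 2 / 3 * D) else 0)) :=
          Finset.sum_le_sum fun α _ => Finset.sum_le_sum fun β _ => hterm α β
      _ = _ := by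
        simp only [Finset.sum_add_distrib, ← Finset.sum_mul, Finset.sum_const, Finset.card_univ,
          Fintype.card_fin, nsmul_eq_mul, Finset.sum_ite_eq, Finset.mem_univ, if_true,
          ← Finset.mul_sum]
        ring
  have hlow : ∑ α : Fin m, lam α ^ 2 * ((X.ricci p (v α) (v α) + X.ricci p (w α) (w α)) -
      2 * (kmax + (2 * (m : ℝ) - 2) / 3 * D)) ≤ F := by
    have : ∑ α : Fin m, lam α ^ 2 * ((X.ricci p (v α) (v α) + X.ricci p (w α) (w α)) -
      2 * (kmax + (2 * (m : ℝ) - 2) / 3 * D)) =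
      (∑ α : Fin m, (lam α) ^ 2 * (X.ricci p (v α) (v α) + X.ricci p (w α) (w α))) -
      2 * ∑ α : Fin m, lam α ^ 2 * (kmax + (2 * (m : ℝ) - 2) / 3 * D) := by
      rw [Finset.mul_sum, ← Finset.sum_sub_distrib]
      exact Finset.sum_congr rfl fun α _ => by ring
    rw [this, hF]
    linarith
  have hpos : ∀ α : Fin m, 0 < (X.ricci p (v α) (v α) + X.ricci p (w α) (w α)) -
      2 * (kmax + (2 * (m : ℝ) - 2) / 3 * D) := fun α => by
    have h1 := hRic p (v α) (hnv α)
    have h2 := hRic p (w α) (hnw α)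
    linarith
  have hnn : ∀ α ∈ Finset.univ, 0 ≤ lam α ^ 2 *
      ((X.ricci p (v α) (v α) + X.ricci p (w α) (w α)) -
      2 * (kmax + (2 * (m : ℝ) - 2) / 3 * D)) :=
    fun α _ => mul_nonneg (sq_nonneg _) (hpos α).le
  have h0 := Finset.sum_nonneg hnn
  refine ⟨h0.trans hlow, fun h => ?_, fun h => ?_⟩
  · rw [h] at hlow
    have hz := (Finset.sum_eq_zero_iff_of_nonneg hnn).mp (le_antisymm hlow h0)
    intro α
    have := hz α (Finset.mem_univ _)
    rcases mul_eq_zero.mp this with h3 | h3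
    · exact pow_eq_zero_iff (two_ne_zero) |>.mp h3
    · exact absurd h3 (hpos α).ne'
  · rw [hF]
    simp [h]
end
end
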